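/- arXiv:1008.5017 — 2 statements merged into one kernel-verified Lean document; each statement's English description precedes it below -/
import Mathlib

section
/- Let u = [Y₁,[Y₂,Y₃]] ∈ L₃ and X ∈ H in a symplectic vector space. Define derivations L_X and L₄ of the tensor algebra corresponding via Poincaré duality to X⊗X and N(X⊗u) respectively. Then 2·L_X L₄ L_X = L_X² L₄ as maps on H. -/
/-! Model of the completed tensor algebra `T̂` of `H = ℚ^d`: an element of `T̂`
is a function assigning to each word in the basis letters (elements of `Fin d`)
its coefficient. -/

namespace Paper

/-- words in the basis letters of `H` -/
abbrev Word (d : ℕ) := List (Fin d)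

/-- the completed tensor algebra, as coefficient functions on words -/
abbrev Ten (d : ℕ) := Word d → ℚ

variable {d : ℕ}

/-- the unit `1 ∈ T̂` -/
def oneT : Ten d := fun w => if w = [] then 1 else 0

/-- the (concatenation) product of `T̂` -/
def mulT (f g : Ten d) : Ten d :=
  fun w => ∑ k ∈ Finset.range (w.length + 1), f (List.take k w) * g (List.drop k w)

/-- the commutator bracket `[a,b] = ab - ba` -/
def brT (f g : Ten d) : Ten d := mulT f g - mulT g f

/-- powers -/
def powT (f : Ten d) : ℕ → Ten d
  | 0 => oneT
  | n + 1 => mulT f (powT f n)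

/-- the cyclic symmetrization operator `N`, with `N|_{H^{⊗p}} = ∑_{m<p} ν^m`
and `N = 0` in degree `0`. -/
def Nop (f : Ten d) : Ten d := fun w => ∑ m ∈ Finset.range w.length, f (w.rotate m)

/-- the cyclic permutation `ν` -/
def nuT (f : Ten d) : Ten d := fun w => f (w.rotate (w.length - 1))

/-- being an element of `H ⊂ T̂` (homogeneous of degree 1) -/
def deg1 (f : Ten d) : Prop := ∀ w : Word d, w.length ≠ 1 → f w = 0

/-- the intersection (symplectic) pairing on the basis of `H = ℚ^{2g}`:
`(A_i · B_i) = 1`, `(B_i · A_i) = -1`, all other pairings `0`, where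
`A_i, B_i` are the letters `2i, 2i+1`. -/
def pairC {g : ℕ} (a b : Fin (2 * g)) : ℚ :=
  if a.val % 2 = 0 ∧ b.val = a.val + 1 then 1
  else if b.val % 2 = 0 ∧ a.val = b.val + 1 then -1 else 0

/-- the symplectic form `ω = ∑ A_i B_i - B_i A_i ∈ H^{⊗2}` -/
def omegaT (g : ℕ) : Ten (2 * g) :=
  fun w => ∑ a : Fin (2 * g), ∑ b : Fin (2 * g),
    pairC a b * (if w = [a, b] then 1 else 0)

/-- the value on the basis letter `b` of the derivation associated to
`f ∈ H ⊗ T̂` via Poincaré duality `X ⊗ u ↦ (Y ↦ (Y·X)u)` -/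
def phiD {g : ℕ} (f : Ten (2 * g)) (b : Fin (2 * g)) : Ten (2 * g) :=
  fun m => ∑ c : Fin (2 * g), pairC b c * f (c :: m)

/-- the derivation of `T̂` associated to `f ∈ H ⊗ T̂` via Poincaré duality,
extended to all of `T̂` by the Leibniz rule. -/
def derOf {g : ℕ} (f t : Ten (2 * g)) : Ten (2 * g) :=
  fun w => ∑ i ∈ Finset.range (w.length + 1), ∑ j ∈ Finset.Icc i w.length,
    ∑ b : Fin (2 * g), t (w.take i ++ b :: w.drop j) * phiD f b ((w.take j).drop i)

/-- the intersection pairing of two elements of `H` -/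
def pairT {g : ℕ} (u v : Ten (2 * g)) : ℚ :=
  ∑ a : Fin (2 * g), ∑ b : Fin (2 * g), u [a] * v [b] * pairC a b

/-- the product of a list of elements of `T̂` -/
def prodL : List (Ten d) → Ten d
  | [] => oneT
  | x :: l => mulT x (prodL l)

/-- the bracket map `H ⊗ T̂ → T̂`, `X ⊗ u ↦ [X,u] = Xu - uX`, in coefficients. -/
def brMap (f : Ten d) : Ten d := fun w => f w - f (w.rotate (w.length - 1))

/-- being homogeneous of degree `n` -/
def HomogT (n : ℕ) (f : Ten d) : Prop := ∀ w : Word d, w.length ≠ n → f w = 0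

lemma HomogT.mulT {n m : ℕ} {f g : Ten d} (hf : HomogT n f) (hg : HomogT m g) :
    HomogT (n + m) (mulT f g) := by
  intro w hw
  refine Finset.sum_eq_zero fun k hk => ?_
  have hk' : k ≤ w.length := by simpa [Nat.lt_succ_iff] using hk
  by_cases h : k = n
  · rw [hg (w.drop k) (by rw [List.length_drop]; omega), mul_zero]
  · rw [hf (w.take k) (by rw [List.length_take]; omega), zero_mul]

lemma HomogT.brT {n m : ℕ} {f g : Ten d} (hf : HomogT n f) (hg : HomogT m g) :
    HomogT (n + m) (brT f g) := by
  intro w hw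
  simp [Paper.brT, hf.mulT hg w hw, hg.mulT hf w (by omega)]

lemma HomogT.Nop {n : ℕ} {f : Ten d} (hf : HomogT n f) : HomogT n (Nop f) := by
  intro w hw
  exact Finset.sum_eq_zero fun m _ => hf _ (by simpa using hw)

lemma HomogT.derOf {g n m : ℕ} {f t : Ten (2 * g)} (hf : HomogT n f) (ht : HomogT m t)
    {w : Word (2 * g)} (hw : w.length + 2 ≠ n + m) : derOf f t w = 0 := by
  refine Finset.sum_eq_zero fun i _ => Finset.sum_eq_zero fun j hj =>
    Finset.sum_eq_zero fun b _ => ?_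
  obtain ⟨hij, hj⟩ := Finset.mem_Icc.mp hj
  by_cases h : j - i + 1 = n
  · rw [ht _ (by simp only [List.length_append, List.length_cons, List.length_take,
      List.length_drop]; omega), zero_mul]
  · rw [phiD, Finset.sum_eq_zero, mul_zero]
    intro c _
    rw [hf _ (by simp only [List.length_cons, List.length_take, List.length_drop]; omega),
      mul_zero]

lemma derOf_add {g : ℕ} (f s t : Ten (2 * g)) :
    derOf f (s + t) = derOf f s + derOf f t := by
  ext w
  simp only [derOf, Pi.add_apply, add_mul, Finset.sum_add_distrib]

lemma derOf_smul {g : ℕ} (f : Ten (2 * g)) (c : ℚ) (t : Ten (2 * g)) :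
    derOf f (c • t) = c • derOf f t := by
  ext w
  simp only [derOf, Pi.smul_apply, smul_eq_mul, mul_assoc, Finset.mul_sum]

lemma derOf_zero {g : ℕ} (f : Ten (2 * g)) : derOf f 0 = 0 := by
  ext w
  simp [derOf]

lemma derOf_sub {g : ℕ} (f s t : Ten (2 * g)) :
    derOf f (s - t) = derOf f s - derOf f t := by
  ext w
  simp only [derOf, Pi.sub_apply, sub_mul, Finset.sum_sub_distrib]

lemma pairC_antisymm {g : ℕ} (a b : Fin (2 * g)) : pairC a b = -pairC b a := by
  unfold pairC
  split_ifs <;> first | omega | norm_num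

lemma pairT_antisymm {g : ℕ} (u v : Ten (2 * g)) : pairT u v = -pairT v u := by
  rw [pairT, Finset.sum_comm]
  simp only [pairT, ← Finset.sum_neg_distrib]
  refine Finset.sum_congr rfl fun a _ => Finset.sum_congr rfl fun b _ => ?_
  rw [pairC_antisymm b a]
  ring

lemma pairT_self {g : ℕ} (u : Ten (2 * g)) : pairT u u = 0 := by
  linarith [pairT_antisymm u u]

/-- the degree `3` component of the product `ABC` of three elements of `H` -/
def tripleT (A B C : Ten d) : Ten d
  | [x, y, z] => A [x] * B [y] * C [z]
  | _ => 0

lemma tripleT_homog (A B C : Ten d) : HomogT 3 (tripleT A B C) := by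
  intro w hw
  match w with
  | [] => rfl
  | [_] => rfl
  | [_, _] => rfl
  | [_, _, _] => simp at hw
  | _ :: _ :: _ :: _ :: _ => rfl

/-- the double bracket `[A,[B,C]]` of three elements of `H` -/
def doubleBr (A B C : Ten d) : Ten d :=
  tripleT A B C - tripleT A C B - tripleT B C A + tripleT C B A

lemma doubleBr_homog (A B C : Ten d) : HomogT 3 (doubleBr A B C) := by
  intro w hw
  simp [doubleBr, tripleT_homog _ _ _ w hw]

lemma doubleBr_self_right (A B : Ten d) : doubleBr A B B = 0 := by
  simp [doubleBr]

lemma doubleBr_apply (A B C : Ten d) (x y z : Fin d) :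
    doubleBr A B C [x, y, z] = A [x] * B [y] * C [z] - A [x] * C [y] * B [z]
      - B [x] * C [y] * A [z] + C [x] * B [y] * A [z] := rfl

lemma mulT_apply_two {X Y : Ten d} (hX : deg1 X) (a b : Fin d) :
    mulT X Y [a, b] = X [a] * Y [b] := by
  simp [mulT, Finset.sum_range_succ, hX [] (by simp), hX [a, b] (by simp)]

lemma mulT_apply_three_left {X Y : Ten d} (hX : deg1 X) (a b c : Fin d) :
    mulT X Y [a, b, c] = X [a] * Y [b, c] := by
  simp [mulT, Finset.sum_range_succ, hX [] (by simp), hX [a, b] (by simp),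
    hX [a, b, c] (by simp)]

lemma mulT_apply_three_right {X Y : Ten d} (hY : deg1 Y) (a b c : Fin d) :
    mulT X Y [a, b, c] = X [a, b] * Y [c] := by
  simp [mulT, Finset.sum_range_succ, hY [] (by simp), hY [b, c] (by simp),
    hY [a, b, c] (by simp)]

lemma mulT_apply_four {X Y : Ten d} (hX : deg1 X) (a b c e : Fin d) :
    mulT X Y [a, b, c, e] = X [a] * Y [b, c, e] := by
  simp [mulT, Finset.sum_range_succ, hX [] (by simp), hX [a, b] (by simp),
    hX [a, b, c] (by simp), hX [a, b, c, e] (by simp)]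

lemma brT_brT_eq_doubleBr {A B C : Ten d} (hA : deg1 A) (hB : deg1 B) (hC : deg1 C) :
    brT A (brT B C) = doubleBr A B C := by
  ext w
  by_cases hw : w.length = 3
  · obtain ⟨x, y, z, rfl⟩ := List.length_eq_three.mp hw
    simp only [brT, Pi.sub_apply, mulT_apply_three_left hA, mulT_apply_three_right hA,
      mulT_apply_two hB, mulT_apply_two hC, doubleBr_apply]
    ring
  · have h : HomogT (1 + (1 + 1)) (brT A (brT B C)) := HomogT.brT hA (HomogT.brT hB hC)
    rw [h w hw, doubleBr_homog _ _ _ w hw]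

/-- `L_X` restricted to `H` is `Z ↦ (Z·X) X`. -/
lemma derOf_mulT_self_deg1 {g : ℕ} {X Z : Ten (2 * g)} (hX : deg1 X) (hZ : deg1 Z) :
    derOf (mulT X X) Z = pairT Z X • X := by
  ext w
  by_cases hw : w.length = 1
  · obtain ⟨x, rfl⟩ := List.length_eq_one_iff.mp hw
    have hI : Finset.Icc 0 1 = ({0, 1} : Finset ℕ) := rfl
    simp only [derOf, phiD, Finset.sum_range_succ, List.length_singleton, hI]
    have hZ' : ∀ w : Word (2 * g), w.length ≠ 1 → Z w = 0 := hZ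
    simp [hZ', mulT_apply_two hX, pairT, Finset.sum_mul, Finset.mul_sum]
    refine Finset.sum_congr rfl fun a _ => Finset.sum_congr rfl fun b _ => ?_
    ring
  · rw [(HomogT.mulT hX hX).derOf hZ (by omega)]
    simp [hX w hw]

/-- `L_X` acts on products of three elements of `H` by the Leibniz rule. -/
lemma derOf_mulT_self_tripleT {g : ℕ} {X : Ten (2 * g)} (hX : deg1 X)
    (A B C : Ten (2 * g)) :
    derOf (mulT X X) (tripleT A B C) = pairT A X • tripleT X B C
      + pairT B X • tripleT A X C + pairT C X • tripleT A B X := by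
  ext w
  by_cases hw : w.length = 3
  · obtain ⟨x, y, z, rfl⟩ := List.length_eq_three.mp hw
    have h0 : Finset.Icc 0 3 = ({0, 1, 2, 3} : Finset ℕ) := rfl
    have h1 : Finset.Icc 1 3 = ({1, 2, 3} : Finset ℕ) := rfl
    have h2 : Finset.Icc 2 3 = ({2, 3} : Finset ℕ) := rfl
    simp only [derOf, phiD, Finset.sum_range_succ, List.length_cons, List.length_nil]
    simp [h0, h1, h2, mulT_apply_two hX, tripleT, pairT, Finset.sum_mul, Finset.mul_sum]
    congr 1
    · congr 1
      all_goals
        refine Finset.sum_congr rfl fun a _ => Finset.sum_congr rfl fun b _ => ?_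
        ring
    · refine Finset.sum_congr rfl fun a _ => Finset.sum_congr rfl fun b _ => ?_
      ring
  · rw [(HomogT.mulT hX hX).derOf (tripleT_homog A B C) (by omega)]
    simp [tripleT_homog _ _ _ w hw]

lemma derOf_mulT_self_doubleBr {g : ℕ} {X : Ten (2 * g)} (hX : deg1 X)
    (A B C : Ten (2 * g)) :
    derOf (mulT X X) (doubleBr A B C) = pairT A X • doubleBr X B C
      + pairT B X • doubleBr A X C + pairT C X • doubleBr A B X := by
  simp only [doubleBr, derOf_add, derOf_sub, derOf_mulT_self_tripleT hX]
  module

/-- The derivation of `N(X ⊗ [Y₁,[Y₂,Y₃]])` restricted to `H`. -/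
lemma derOf_Nop_deg1 {g : ℕ} {X Y1 Y2 Y3 Z : Ten (2 * g)}
    (hX : deg1 X) (hY1 : deg1 Y1) (hY2 : deg1 Y2) (hY3 : deg1 Y3) (hZ : deg1 Z) :
    derOf (Nop (mulT X (brT Y1 (brT Y2 Y3)))) Z =
      pairT Z X • doubleBr Y1 Y2 Y3 - pairT Z Y1 • doubleBr X Y2 Y3
        + pairT Z Y2 • doubleBr Y3 X Y1 - pairT Z Y3 • doubleBr Y2 X Y1 := by
  rw [brT_brT_eq_doubleBr hY1 hY2 hY3]
  ext w
  by_cases hw : w.length = 3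
  · obtain ⟨x, y, z, rfl⟩ := List.length_eq_three.mp hw
    have h0 : Finset.Icc 0 3 = ({0, 1, 2, 3} : Finset ℕ) := rfl
    have h1 : Finset.Icc 1 3 = ({1, 2, 3} : Finset ℕ) := rfl
    have h2 : Finset.Icc 2 3 = ({2, 3} : Finset ℕ) := rfl
    have hder : ∀ f : Ten (2 * g), derOf f Z [x, y, z] =
        ∑ b, Z [b] * ∑ c, pairC b c * f [c, x, y, z] := by
      intro f
      simp only [derOf, phiD, Finset.sum_range_succ, List.length_cons, List.length_nil]
      have hZ' : ∀ w : Word (2 * g), w.length ≠ 1 → Z w = 0 := hZ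
      simp [h0, h1, h2, hZ']
    have hN : ∀ c, Nop (mulT X (doubleBr Y1 Y2 Y3)) [c, x, y, z] =
        X [c] * doubleBr Y1 Y2 Y3 [x, y, z] + X [x] * doubleBr Y1 Y2 Y3 [y, z, c]
        + X [y] * doubleBr Y1 Y2 Y3 [z, c, x] + X [z] * doubleBr Y1 Y2 Y3 [c, x, y] := by
      intro c
      simp [Nop, Finset.sum_range_succ, mulT_apply_four hX]
    rw [hder]
    simp only [hN, Pi.add_apply, Pi.sub_apply, Pi.smul_apply, smul_eq_mul, doubleBr_apply,
      pairT, Finset.sum_mul, Finset.mul_sum, ← Finset.sum_add_distrib,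
      ← Finset.sum_sub_distrib]
    refine Finset.sum_congr rfl fun a _ => Finset.sum_congr rfl fun b _ => ?_
    ring
  · rw [(HomogT.Nop (HomogT.mulT hX (doubleBr_homog Y1 Y2 Y3))).derOf hZ (by omega)]
    simp [doubleBr_homog _ _ _ w hw]

/-- Let `u = [Y₁,[Y₂,Y₃]] ∈ 𝓛₃` and `X ∈ H` in a symplectic
vector space, and let `L_X` and `L₄` be the derivations of `T̂` corresponding
via Poincaré duality to `X ⊗ X` and `N(X ⊗ u)` respectively.  Then
`2 L_X L₄ L_X = L_X² L₄` as maps on `H`. -/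
theorem two_LX_L4_LX_eq (g : ℕ) (X Y1 Y2 Y3 : Ten (2 * g))
    (hX : deg1 X) (hY1 : deg1 Y1) (hY2 : deg1 Y2) (hY3 : deg1 Y3) :
    ∀ Z : Ten (2 * g), deg1 Z → ∀ w : Word (2 * g),
      2 * derOf (mulT X X) (derOf (Nop (mulT X (brT Y1 (brT Y2 Y3))))
          (derOf (mulT X X) Z)) w
        = derOf (mulT X X) (derOf (mulT X X)
            (derOf (Nop (mulT X (brT Y1 (brT Y2 Y3)))) Z)) w := by
  intro Z hZ w
  simp only [derOf_mulT_self_deg1 hX hZ, derOf_smul,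
    derOf_Nop_deg1 hX hY1 hY2 hY3 hX, derOf_Nop_deg1 hX hY1 hY2 hY3 hZ, derOf_add, derOf_sub,
    derOf_zero, smul_zero,
    derOf_mulT_self_doubleBr hX, pairT_self, doubleBr_self_right]
  rw [pairT_antisymm X Y1, pairT_antisymm X Y2, pairT_antisymm X Y3]
  simp only [doubleBr, Pi.add_apply, Pi.sub_apply, Pi.smul_apply, Pi.zero_apply, smul_eq_mul]
  ring

end Paper
end

section
/- Define ξ on the tensor algebra T of H with values in (T⊗T)⊗H (modulo the identification with the relative tensor product over T via the coproduct-twisted action) by ξ(u) = 1 ⊗ (Δu − u⊗1). Then for any monomial, ξ(X₁⋯X_n) = Σ_{i=1}^n (X₁⋯X_{i−1} ⊗ X_{i+1}⋯X_n) ⊗ X_i. -/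
/-! Model of the completed tensor algebra `T̂` of `H = ℚ^d`: an element of `T̂`
is a function assigning to each word in the basis letters (elements of `Fin d`)
its coefficient. -/

namespace Paper

variable {d : ℕ}

/-- `shuffleCount p q m` is the number of ways the word `m` arises as a shuffle
of the words `p` and `q`; these are the structure constants of the (unshuffle)
coproduct `Δ` of `T̂`, determined by `Δ(X) = X⊗1 + 1⊗X` for `X ∈ H`. -/
def shuffleCount : Word d → Word d → Word d → ℕ
  | [], q, m => if q = m then 1 else 0
  | p, [], m => if p = m then 1 else 0
  | _ :: _, _ :: _, [] => 0
  | a :: p, b :: q, c :: m =>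
      (if a = c then shuffleCount p (b :: q) m else 0) +
      (if b = c then shuffleCount (a :: p) q m else 0)

/-- the coproduct `Δ : T̂ → T̂ ⊗̂ T̂` in coefficients: `DeltaT v a b` is the
coefficient of `a ⊗ b` in `Δ(v)`. -/
def DeltaT (v : Ten d) (a b : Word d) : ℚ :=
  ∑ m ∈ (a ++ b).permutations.toFinset, v m * (shuffleCount a b m : ℚ)

/-- the canonical form of `ξ(v) = 1 ⊗ (Δv - v⊗1) ∈ (T̂^r ⊗̂ T̂^l) ⊗_{T̂} T̂₁`:
since `T̂₁` is a free left `T̂`-module on the last letter, every element of the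
relative tensor product has a unique expansion `∑ A_X ⊗ B_X ⊗ X` with `X ∈ H`;
`canonXi v p q x` is the resulting coefficient of `p ⊗ q ⊗ x`, obtained from
the definition `ξ(v) = 1 ⊗ (Δv - v⊗1)` by moving the `T̂`-factor in front of
the last letter across the tensor product via the (antipode-twisted) action of
`T̂` on `T̂^r ⊗̂ T̂^l`. -/
def canonXi (v : Ten d) (p q : Word d) (x : Fin d) : ℚ :=
  ∑ j ∈ Finset.range (q.length + 1), (-1 : ℚ) ^ j *
    ∑ m ∈ ((q.take j).reverse ++ p).permutations.toFinset,
      (shuffleCount (q.take j).reverse p m : ℚ) * DeltaT v (q.drop j) (m ++ [x])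

/-- The shuffles of two words, listed with multiplicity. -/
def shuffles : Word d → Word d → List (Word d)
  | [], q => [q]
  | a :: p, [] => [a :: p]
  | a :: p, b :: q =>
      (shuffles p (b :: q)).map (List.cons a) ++ (shuffles (a :: p) q).map (List.cons b)
termination_by p q => p.length + q.length

theorem count_map_cons (a c : Fin d) (l : List (Word d)) (m : Word d) :
    (l.map (List.cons a)).count (c :: m) = if a = c then l.count m else 0 := by
  split_ifs with h
  · subst h
    exact List.count_map_of_injective l _ (List.cons_injective) m
  · rw [List.count_eq_zero]
    simp [h]

theorem shuffleCount_eq_count (p q m : Word d) :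
    shuffleCount p q m = (shuffles p q).count m := by
  induction m generalizing p q with
  | nil =>
    rcases p with _ | ⟨a, p⟩ <;> rcases q with _ | ⟨b, q⟩ <;>
      simp [shuffleCount, shuffles]
    rw [List.count_eq_zero.2 (by simp), List.count_eq_zero.2 (by simp)]
  | cons c m ih =>
    rcases p with _ | ⟨a, p⟩
    · simp [shuffleCount, shuffles, List.count_singleton]
    rcases q with _ | ⟨b, q⟩
    · simp [shuffleCount, shuffles, List.count_singleton]
    simp only [shuffleCount, shuffles, List.count_append, count_map_cons, ih]

theorem perm_of_mem_shuffles {p q m : Word d} (h : m ∈ shuffles p q) : m.Perm (p ++ q) := by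
  induction p, q using shuffles.induct generalizing m with
  | case1 q => simp_all [shuffles]
  | case2 a p => simp_all [shuffles]
  | case3 a p b q ih₁ ih₂ =>
    simp only [shuffles, List.mem_append, List.mem_map] at h
    rcases h with ⟨m, hm, rfl⟩ | ⟨m, hm, rfl⟩
    · exact (ih₁ hm).cons a
    · exact ((ih₂ hm).cons b).trans List.perm_middle.symm

theorem DeltaT_eq_sum_shuffles (v : Ten d) (p q : Word d) :
    DeltaT v p q = ((shuffles p q).map v).sum := by
  rw [Finset.sum_list_map_count, DeltaT]
  symm
  trans ∑ m ∈ (shuffles p q).toFinset, v m * (shuffleCount p q m : ℚ)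
  · refine Finset.sum_congr rfl fun m _ => ?_
    rw [shuffleCount_eq_count, nsmul_eq_mul, mul_comm]
    congr!
  · refine Finset.sum_subset (fun m hm => ?_) fun m _ hm => ?_
    · simpa using perm_of_mem_shuffles (by simpa using hm)
    · rw [shuffleCount_eq_count, List.count_eq_zero.2 (by simpa using hm)]
      simp

theorem DeltaT_nil_left (v : Ten d) (q : Word d) : DeltaT v [] q = v q := by
  simp [DeltaT_eq_sum_shuffles, shuffles]

theorem DeltaT_nil_right (v : Ten d) (p : Word d) : DeltaT v p [] = v p := by
  cases p <;> simp [DeltaT_eq_sum_shuffles, shuffles]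

theorem DeltaT_cons_cons (v : Ten d) (a b : Fin d) (p q : Word d) :
    DeltaT v (a :: p) (b :: q) =
      DeltaT (fun m => v (a :: m)) p (b :: q) + DeltaT (fun m => v (b :: m)) (a :: p) q := by
  simp [DeltaT_eq_sum_shuffles, shuffles, Function.comp_def]

theorem DeltaT_add (v w : Ten d) (p q : Word d) :
    DeltaT (fun m => v m + w m) p q = DeltaT v p q + DeltaT w p q := by
  simp [DeltaT_eq_sum_shuffles, List.sum_map_add]

/-- The pairing of `v` with the shuffle of `s` and `(r ⧢ p) x`. -/
def pairXi (x : Fin d) (v : Ten d) (r p s : Word d) : ℚ :=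
  DeltaT (fun m => DeltaT v s (m ++ [x])) r p

/-- The part of a functional on words carried by words whose first letter is that of `w`. -/
def onHead (F : Ten d → Word d → ℚ) (v : Ten d) : Word d → ℚ
  | [] => 0
  | a :: w => F (fun m => v (a :: m)) w

theorem pairXi_eq_onHead (x : Fin d) (v : Ten d) (r p s : Word d) :
    pairXi x v r p s =
      onHead (fun v r => pairXi x v r p s) v r + onHead (fun v p => pairXi x v r p s) v p +
      onHead (fun v s => pairXi x v r p s) v s + if r = [] ∧ p = [] then v (x :: s) else 0 := by
  rcases r with _ | ⟨a, r⟩ <;> rcases p with _ | ⟨b, p⟩ <;> rcases s with _ | ⟨c, s⟩ <;>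
    simp [pairXi, onHead, DeltaT_nil_left, DeltaT_nil_right, DeltaT_cons_cons, DeltaT_add] <;>
    ring

theorem sum_pairXi (x : Fin d) (v : Ten d) (p q : Word d) :
    ∑ j ∈ Finset.range (q.length + 1),
      (-1 : ℚ) ^ j * pairXi x v (q.take j).reverse p (q.drop j) = v (p ++ x :: q) := by
  have cancel (v : Ten d) (p : Word d) :
      ∑ j ∈ Finset.range (q.length + 1),
          (-1 : ℚ) ^ j * onHead (fun v r => pairXi x v r p (q.drop j)) v (q.take j).reverse +
        ∑ j ∈ Finset.range (q.length + 1),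
          (-1 : ℚ) ^ j * onHead (fun v s => pairXi x v (q.take j).reverse p s) v (q.drop j)
      = 0 := by
    rw [Finset.sum_range_succ', Finset.sum_range_succ (n := q.length)]
    simp only [List.take_zero, List.reverse_nil, List.drop_length, onHead, mul_zero, add_zero]
    rw [← Finset.sum_add_distrib]
    refine Finset.sum_eq_zero fun j hj => ?_
    have hj : j < q.length := Finset.mem_range.1 hj
    rw [List.take_succ_eq_append_getElem hj, List.drop_eq_getElem_cons hj,
      List.reverse_append, List.reverse_singleton, List.singleton_append]
    ring_nf
  induction p generalizing v with
  | nil =>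
    simp_rw [pairXi_eq_onHead x v, mul_add, Finset.sum_add_distrib]
    have h := cancel v []
    have : ∑ j ∈ Finset.range (q.length + 1), (-1 : ℚ) ^ j *
        (if (q.take j).reverse = [] ∧ True then v (x :: q.drop j) else 0)
        = v (x :: q) := by
      rw [Finset.sum_eq_single 0]
      · simp
      · intro j hj h0
        have : (q.take j).reverse ≠ [] := by
          rw [← List.length_pos_iff]
          simp at hj ⊢
          by_contra! hq
          rcases q with _ | ⟨c, q⟩ <;> simp_all
        simp [this]
      · simp
    rw [this]
    simp only [onHead, mul_zero, Finset.sum_const_zero, List.nil_append] at h ⊢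
    linarith
  | cons b p ih =>
    simp_rw [pairXi_eq_onHead x v, mul_add, Finset.sum_add_distrib]
    have h := cancel v (b :: p)
    have h' := ih (fun m => v (b :: m))
    simp only [onHead, reduceCtorEq, and_false, if_false, mul_zero, Finset.sum_const_zero,
      List.cons_append] at h h' ⊢
    linarith

theorem canonXi_eq (v : Ten d) (p q : Word d) (x : Fin d) :
    canonXi v p q x = v (p ++ x :: q) := by
  rw [← sum_pairXi x v p q]
  simp only [canonXi, pairXi]
  refine Finset.sum_congr rfl fun j _ => ?_
  congr 1
  rw [DeltaT]
  exact Finset.sum_congr rfl fun m _ => mul_comm _ _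

theorem mulT_deg1_nil {f : Ten d} (hf : deg1 f) (g : Ten d) : mulT f g [] = 0 := by
  simp [mulT, hf []]

theorem mulT_deg1_cons {f : Ten d} (hf : deg1 f) (g : Ten d) (a : Fin d) (w : Word d) :
    mulT f g (a :: w) = f [a] * g w := by
  rw [mulT, Finset.sum_eq_single 1]
  · simp
  · intro k hk h1
    rw [hf, zero_mul]
    simp at hk ⊢
    omega
  · simp

theorem prodL_eq_zero {L : List (Ten d)} (hL : ∀ f ∈ L, deg1 f) {w : Word d}
    (h : w.length ≠ L.length) : prodL L w = 0 := by
  induction L generalizing w with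
  | nil => simp_all [prodL, oneT]
  | cons f L ih =>
    rcases w with _ | ⟨a, w⟩
    · exact mulT_deg1_nil (hL f (by simp)) _
    · rw [prodL, mulT_deg1_cons (hL f (by simp)), ih (fun g hg => hL g (by simp [hg])), mul_zero]
      simpa using h

theorem prodL_append {L₁ : List (Ten d)} (hL : ∀ f ∈ L₁, deg1 f) (L₂ : List (Ten d))
    {w₁ : Word d} (h : w₁.length = L₁.length) (w₂ : Word d) :
    prodL (L₁ ++ L₂) (w₁ ++ w₂) = prodL L₁ w₁ * prodL L₂ w₂ := by
  induction L₁ generalizing w₁ with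
  | nil => simp_all [prodL, oneT]
  | cons f L ih =>
    rcases w₁ with _ | ⟨a, w⟩
    · simp at h
    · have hf := hL f (by simp)
      simp only [List.cons_append, prodL, mulT_deg1_cons hf]
      rw [ih (fun g hg => hL g (by simp [hg])) (by simpa using h), mul_assoc]

/-- With `ξ(u) = 1 ⊗ (Δu - u⊗1)` valued in
`(T^r ⊗ T^l) ⊗_T T₁`, for any monomial `X₁⋯X_n` (`X_i ∈ H`) one has
`ξ(X₁⋯X_n) = ∑_{i=1}^n (X₁⋯X_{i-1} ⊗ X_{i+1}⋯X_n) ⊗ X_i`, as an identity of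
canonical forms in the relative tensor product. -/
theorem xi_monomial (d n : ℕ) (X : Fin n → Ten d) (hX : ∀ i, deg1 (X i)) :
    canonXi (prodL (List.ofFn X)) = fun (p q : Word d) (x : Fin d) =>
      ∑ i : Fin n, prodL ((List.ofFn X).take (i : ℕ)) p *
        prodL ((List.ofFn X).drop ((i : ℕ) + 1)) q * X i [x] := by
  funext p q x
  rw [canonXi_eq]
  have hL : ∀ f ∈ List.ofFn X, deg1 f := by
    intro f hf
    obtain ⟨i, rfl⟩ := List.mem_ofFn.1 hf
    exact hX i
  have h_take (i : ℕ) : ∀ f ∈ (List.ofFn X).take i, deg1 f :=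
    fun f hf => hL f (List.mem_of_mem_take hf)
  by_cases hp : p.length < n
  · rw [Finset.sum_eq_single ⟨p.length, hp⟩]
    · have hp' : p.length < (List.ofFn X).length := by simpa using hp
      conv_lhs => rw [← List.take_append_drop p.length (List.ofFn X)]
      rw [prodL_append (h_take _) _ (by simp [hp.le]), List.drop_eq_getElem_cons hp', prodL,
        List.getElem_ofFn, mulT_deg1_cons (hX _)]
      ring
    · intro i _ hi
      have : p.length ≠ i := fun h => hi (Fin.ext h.symm)
      rw [prodL_eq_zero (h_take _) (by simpa [i.isLt.le] using this), zero_mul, zero_mul]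
    · simp
  · rw [prodL_eq_zero hL (by simp; omega)]
    refine (Finset.sum_eq_zero fun i _ => ?_).symm
    rw [prodL_eq_zero (h_take _) (by simp [i.isLt.le]; omega), zero_mul, zero_mul]

end Paper
end
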